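/- Let I be a workflow instance with constraint graph G and let (T, X) be a rooted tree decomposition of the Hasse diagram D of (U, <). Let i be a join node with bag B whose two children have bags B' and B'' with B = B' = B'' (as sets of users). Let T' ⊆ S, R : T' → B ∪ {[<],[>],[∼]}^{|B|}, and X = {x ∈ T' : R(x) ∈ B}. Then a (B, T', R)-plan exists if and only if there is a partition of T' \ X into sets X' and X'' such that: (i) a (B', X ∪ X', R restricted to X ∪ X')-plan exists; (ii) a (B'', X ∪ X'', R restricted to X ∪ X'')-plan exists; and (iii) for every arc of G from a step a to a step b such that one of a, b lies in X' and the other lies in X'', there exists u ∈ B such that the coordinate of the tuple R(a) at u is [<] and the coordinate of the tuple R(b) at u is [>]. -/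

import Mathlib

/-- The three symbols `[<]`, `[>]`, `[∼]`. -/
inductive Rel3 : Type where
  | lt : Rel3
  | gt : Rel3
  | sim : Rel3
deriving DecidableEq

open Classical in
/-- The relation `φ(v, u)` of a user `v` to a user `u`: `[<]` if `v < u`, `[>]` if
`u < v`, and `[∼]` otherwise. -/
noncomputable def phi {U : Type*} [PartialOrder U] (v u : U) : Rel3 :=
  if v < u then Rel3.lt else if u < v then Rel3.gt else Rel3.sim

/-- `j` is a descendant of `i` in the tree `T` rooted at `r`: `j ≠ i` and `i` lies on
the (unique) path in `T` from the root `r` to `j`. -/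
def IsDesc {ι : Type*} (T : SimpleGraph ι) (r i j : ι) : Prop :=
  j ≠ i ∧ ∀ p : T.Walk r j, p.IsPath → i ∈ p.support

/-- The set of users lying in the bag of node `i` or in the bag of a descendant of `i`
(in the tree `T` with bags `Bags`, rooted at `r`). -/
def allowedUsers {ι U : Type*} (T : SimpleGraph ι) (r : ι) (Bags : ι → Set U) (i : ι) :
    Set U :=
  Bags i ∪ ⋃ j ∈ {j | IsDesc T r i j}, Bags j

/-- A `(B, T', R)`-plan for the workflow instance with authorization lists `L`,
separation-of-duty constraints `Gne` (the undirected edges of the constraint graph),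
seniority constraints `Glt` (the arcs of the constraint graph), bag `Bag`, and set
`Allowed` of users lying in `Bag` or in the bag of a descendant node.  Here the values
of `R` and `π` are relevant only on the set `T'` of steps; tuples over the bag are
represented as functions `↥Bag → Rel3`. -/
def IsBTRPlan {S U : Type*} [PartialOrder U]
    (L : S → Set U) (Gne Glt : S → S → Prop)
    (Bag Allowed : Set U) (T' : Set S)
    (R : S → ↥Bag ⊕ (↥Bag → Rel3)) (π : S → U) : Prop :=
  (∀ x ∈ T', π x ∈ L x) ∧
  (∀ x ∈ T', ∀ y ∈ T', Gne x y → π x ≠ π y) ∧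
  (∀ x ∈ T', ∀ y ∈ T', Glt x y → π x < π y) ∧
  (∀ x ∈ T', π x ∈ Allowed) ∧
  (∀ x ∈ T', ∀ u : ↥Bag, (π x = ↑u ↔ R x = Sum.inl u)) ∧
  (∀ x ∈ T', ∀ f : ↥Bag → Rel3, R x = Sum.inr f → ∀ u : ↥Bag, phi (π x) ↑u = f u)

theorem phi_eq_lt_iff {U : Type*} [PartialOrder U] {v u : U} :
    phi v u = Rel3.lt ↔ v < u := by
  unfold phi
  split_ifs <;> simp_all

theorem phi_eq_gt_iff {U : Type*} [PartialOrder U] {v u : U} :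
    phi v u = Rel3.gt ↔ u < v := by
  unfold phi
  split_ifs with h h'
  · simp [h.asymm]
  all_goals simp_all

/-- The nodes of the subtree of `T`, rooted at `r`, below the node `k`, with `k` included. -/
def subtreeNodes {ι : Type*} (T : SimpleGraph ι) (r k : ι) : Set ι :=
  {j | ∀ p : T.Walk r j, p.IsPath → k ∈ p.support}

section Subtree

variable {ι : Type*} {T : SimpleGraph ι} {r : ι}

theorem self_mem_subtreeNodes (k : ι) : k ∈ subtreeNodes T r k :=
  fun p _ => p.end_mem_support

theorem eq_of_root_mem_subtreeNodes {k : ι} (h : r ∈ subtreeNodes T r k) : k = r := by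
  simpa using h SimpleGraph.Walk.nil (by simp)

theorem eq_of_adj_of_mem_subtreeNodes_of_notMem {k j l : ι} (hjl : T.Adj j l)
    (hj : j ∈ subtreeNodes T r k) (hl : l ∉ subtreeNodes T r k) : j = k := by
  classical
  simp only [subtreeNodes, Set.mem_ofPred_eq, not_forall] at hl
  obtain ⟨p, hp, hk⟩ := hl
  by_cases hjp : j ∈ p.support
  · exact absurd (p.support_takeUntil_subset_support hjp (hj _ (hp.takeUntil hjp))) hk
  · have := hj _ (hp.concat hjp hjl.symm)
    rw [SimpleGraph.Walk.support_concat] at this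
    simp only [List.mem_append, List.mem_singleton] at this
    exact (this.resolve_left hk).symm

theorem subtreeNodes_subset_of_mem {i k : ι} (hk : k ∈ subtreeNodes T r i) :
    subtreeNodes T r k ⊆ subtreeNodes T r i := by
  classical
  intro j hj p hp
  exact p.support_takeUntil_subset_support (hj p hp) (hk _ (hp.takeUntil _))

theorem notMem_subtreeNodes_of_mem (hT : T.Preconnected) {i k : ι}
    (hk : k ∈ subtreeNodes T r i) (hne : k ≠ i) : i ∉ subtreeNodes T r k := by
  classical
  intro hi
  obtain ⟨p, hp⟩ := (hT r i).exists_isPath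
  exact SimpleGraph.Walk.endpoint_notMem_support_takeUntil hp (hi p hp) hne.symm
    (hk _ (hp.takeUntil _))

theorem eq_of_adj_of_notMem_subtreeNodes (hT : T.IsAcyclic) {k j l : ι}
    (hj : j ∉ subtreeNodes T r k) (hl : l ∉ subtreeNodes T r k)
    (hjk : T.Adj j k) (hlk : T.Adj l k) : j = l := by
  simp only [subtreeNodes, Set.mem_ofPred_eq, not_forall] at hj hl
  obtain ⟨p, hp, hkp⟩ := hj
  obtain ⟨q, hq, hkq⟩ := hl
  have h := (hT.subsingleton_path r k).elim ⟨_, hp.concat hkp hjk⟩ ⟨_, hq.concat hkq hlk⟩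
  exact (SimpleGraph.Walk.concat_inj (congrArg Subtype.val h)).1

theorem root_mem_of_adj_closed (hT : T.Preconnected) {E : Set ι} {j : ι} (hj : j ∈ E)
    (hE : ∀ j ∈ E, ∀ l, T.Adj j l → l ∈ E) : r ∈ E := by
  by_contra hr
  obtain ⟨d, -, h₁, h₂⟩ := (hT j r).some.exists_boundary_dart E hj hr
  exact h₂ (hE _ h₁ _ d.adj)

theorem disjoint_subtreeNodes (hT : T.Preconnected) {i k l : ι}
    (hk : k ∈ subtreeNodes T r i) (hl : l ∈ subtreeNodes T r i)
    (hik : T.Adj i k) (hil : T.Adj i l) (hne : k ≠ l) :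
    Disjoint (subtreeNodes T r k) (subtreeNodes T r l) := by
  have hlk : l ∉ subtreeNodes T r k := fun h => hne
    (eq_of_adj_of_mem_subtreeNodes_of_notMem hil.symm h
      (notMem_subtreeNodes_of_mem hT hk hik.ne')).symm
  have hkl : k ∉ subtreeNodes T r l := fun h => hne
    (eq_of_adj_of_mem_subtreeNodes_of_notMem hik.symm h
      (notMem_subtreeNodes_of_mem hT hl hil.ne'))
  rw [Set.disjoint_left]
  intro j hjk hjl
  have hr : r ∈ subtreeNodes T r k ∩ subtreeNodes T r l := by
    refine root_mem_of_adj_closed hT ⟨hjk, hjl⟩ fun a ha b hab => ⟨?_, ?_⟩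
    · by_contra hb
      exact hkl (eq_of_adj_of_mem_subtreeNodes_of_notMem hab ha.1 hb ▸ ha.2)
    · by_contra hb
      exact hlk (eq_of_adj_of_mem_subtreeNodes_of_notMem hab ha.2 hb ▸ ha.1)
  exact hne ((eq_of_root_mem_subtreeNodes hr.1).trans (eq_of_root_mem_subtreeNodes hr.2).symm)

theorem exists_child_of_mem_subtreeNodes (hT : T.IsTree) {i j : ι}
    (hj : j ∈ subtreeNodes T r i) (hji : j ≠ i) :
    ∃ k, T.Adj i k ∧ k ∈ subtreeNodes T r i ∧ j ∈ subtreeNodes T r k := by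
  by_contra! h
  have hr : r ∈ {j | j ∈ subtreeNodes T r i ∧ j ≠ i ∧
      ∀ k, T.Adj i k → k ∈ subtreeNodes T r i → j ∉ subtreeNodes T r k} := by
    refine root_mem_of_adj_closed hT.connected.preconnected ⟨hj, hji, h⟩ ?_
    rintro a ⟨ha, hai, hak⟩ b hab
    refine ⟨?_, ?_, fun k hik hk hbk => ?_⟩
    · by_contra hb
      exact hai (eq_of_adj_of_mem_subtreeNodes_of_notMem hab ha hb)
    · rintro rfl
      exact hak a hab.symm ha (self_mem_subtreeNodes a)
    · obtain rfl := eq_of_adj_of_mem_subtreeNodes_of_notMem hab.symm hbk (hak k hik hk)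
      exact hai (eq_of_adj_of_notMem_subtreeNodes hT.isAcyclic (hak b hik hk)
        (notMem_subtreeNodes_of_mem hT.connected.preconnected hk hik.ne') hab hik)
  exact hr.2.1 (eq_of_root_mem_subtreeNodes hr.1).symm

theorem mem_allowedUsers_iff {U : Type*} {Bags : ι → Set U} {i : ι} {u : U} :
    u ∈ allowedUsers T r Bags i ↔ ∃ j ∈ subtreeNodes T r i, u ∈ Bags j := by
  simp only [allowedUsers, Set.mem_union, Set.mem_iUnion, Set.mem_ofPred_eq, exists_prop]
  constructor
  · rintro (h | ⟨j, hj, h⟩)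
    · exact ⟨i, self_mem_subtreeNodes i, h⟩
    · exact ⟨j, hj.2, h⟩
  · rintro ⟨j, hj, h⟩
    obtain rfl | hji := eq_or_ne j i
    · exact Or.inl h
    · exact Or.inr ⟨j, ⟨hji, hj⟩, h⟩

theorem allowedUsers_mono {U : Type*} {Bags : ι → Set U} {i k : ι}
    (hk : k ∈ subtreeNodes T r i) : allowedUsers T r Bags k ⊆ allowedUsers T r Bags i := by
  intro u hu
  obtain ⟨j, hj, hu⟩ := mem_allowedUsers_iff.1 hu
  exact mem_allowedUsers_iff.2 ⟨j, subtreeNodes_subset_of_mem hk hj, hu⟩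

theorem mem_bag_of_mem_of_notMem_subtreeNodes {U : Type*} {Bags : ι → Set U} {u : U}
    (hconn : (T.induce {i | u ∈ Bags i}).Connected) {j k l : ι}
    (hj : j ∈ subtreeNodes T r k) (hl : l ∉ subtreeNodes T r k)
    (huj : u ∈ Bags j) (hul : u ∈ Bags l) : u ∈ Bags k := by
  obtain ⟨d, -, h₁, h₂⟩ := (hconn.preconnected ⟨j, huj⟩ ⟨l, hul⟩).some.exists_boundary_dart
    {x | x.1 ∈ subtreeNodes T r k} hj hl
  have hd : T.Adj d.fst.1 d.snd.1 := d.adj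
  have hmem := d.fst.2
  rw [eq_of_adj_of_mem_subtreeNodes_of_notMem hd h₁ h₂] at hmem
  exact hmem

theorem mem_bag_of_mem_allowedUsers {U : Type*} {Bags : ι → Set U} {u : U}
    (hconn : (T.induce {i | u ∈ Bags i}).Connected) {k l : ι}
    (hdisj : Disjoint (subtreeNodes T r k) (subtreeNodes T r l))
    (hk : u ∈ allowedUsers T r Bags k) (hl : u ∈ allowedUsers T r Bags l) : u ∈ Bags k := by
  obtain ⟨a, ha, hua⟩ := mem_allowedUsers_iff.1 hk
  obtain ⟨b, hb, hub⟩ := mem_allowedUsers_iff.1 hl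
  exact mem_bag_of_mem_of_notMem_subtreeNodes hconn ha (Set.disjoint_right.1 hdisj hb) hua hub

/-- A bag of a tree decomposition of the Hasse diagram separates the users below it from the
remaining ones with respect to the order. -/
theorem exists_mem_bag_between {U : Type*} [Finite U] [PartialOrder U] {Bags : ι → Set U}
    (harc : ∀ u v : U, u ⋖ v → ∃ i, u ∈ Bags i ∧ v ∈ Bags i)
    (hconn : ∀ u : U, (T.induce {i | u ∈ Bags i}).Connected) {k : ι} {v w : U}
    (hvw : v < w) (hv : v ∈ allowedUsers T r Bags k) (hw : w ∉ allowedUsers T r Bags k) :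
    ∃ u ∈ Bags k, v ≤ u ∧ u < w := by
  have : IsStronglyAtomic U := IsStronglyAtomic.of_wellFounded_lt wellFounded_lt
  obtain ⟨x, hx⟩ := (Set.toFinite {x | v ≤ x ∧ x < w ∧ x ∈ allowedUsers T r Bags k}).exists_maximal
    ⟨v, le_rfl, hvw, hv⟩
  obtain ⟨hvx, hxw, hxk⟩ := hx.prop
  obtain ⟨y, hxy, hyw⟩ := exists_covBy_le_of_lt hxw
  have hyk : y ∉ allowedUsers T r Bags k := fun hyk =>
    hxy.lt.not_ge (hx.le_of_ge ⟨hvx.trans hxy.le, hyw.lt_of_ne fun h => hw (h ▸ hyk), hyk⟩ hxy.le)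
  obtain ⟨j, hxj, hyj⟩ := harc x y hxy
  obtain ⟨l, hl, hxl⟩ := mem_allowedUsers_iff.1 hxk
  exact ⟨x, mem_bag_of_mem_of_notMem_subtreeNodes (hconn x) hl
    (fun hj => hyk (mem_allowedUsers_iff.2 ⟨j, hj, hyj⟩)) hxl hxj, hvx, hxw⟩

end Subtree

theorem IsBTRPlan.mono {S U : Type*} [PartialOrder U] {L : S → Set U} {Gne Glt : S → S → Prop}
    {Bag A A' : Set U} {T' X : Set S} {R : S → ↥Bag ⊕ (↥Bag → Rel3)} {π : S → U}
    (h : IsBTRPlan L Gne Glt Bag A T' R π) (hX : X ⊆ T') (hA : ∀ x ∈ X, π x ∈ A') :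
    IsBTRPlan L Gne Glt Bag A' X R π :=
  ⟨fun x hx => h.1 x (hX hx), fun x hx y hy => h.2.1 x (hX hx) y (hX hy),
    fun x hx y hy => h.2.2.1 x (hX hx) y (hX hy), hA,
    fun x hx => h.2.2.2.2.1 x (hX hx), fun x hx => h.2.2.2.2.2 x (hX hx)⟩

theorem IsBTRPlan.notMem_bag {S U : Type*} [PartialOrder U] {L : S → Set U}
    {Gne Glt : S → S → Prop} {Bag A : Set U} {T' : Set S} {R : S → ↥Bag ⊕ (↥Bag → Rel3)}
    {π : S → U} (h : IsBTRPlan L Gne Glt Bag A T' R π) {x : S} (hx : x ∈ T')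
    (hR : ¬ ∃ u, R x = Sum.inl u) : π x ∉ Bag :=
  fun hB => hR ⟨⟨π x, hB⟩, (h.2.2.2.2.1 x hx ⟨π x, hB⟩).1 rfl⟩

theorem IsBTRPlan.exists_separating_of_between {S U : Type*} [PartialOrder U] {L : S → Set U}
    {Gne Glt : S → S → Prop} {Bag A : Set U} {T' : Set S} {R : S → ↥Bag ⊕ (↥Bag → Rel3)}
    {π : S → U} (h : IsBTRPlan L Gne Glt Bag A T' R π) {a b : S} (ha : a ∈ T') (hb : b ∈ T')
    (hRa : ¬ ∃ u, R a = Sum.inl u) (hRb : ¬ ∃ u, R b = Sum.inl u)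
    (hu : ∃ u ∈ Bag, π a ≤ u ∧ u < π b) :
    ∃ (u : ↥Bag) (f g : ↥Bag → Rel3),
      R a = Sum.inr f ∧ R b = Sum.inr g ∧ f u = Rel3.lt ∧ g u = Rel3.gt := by
  obtain ⟨u, huB, hau, hub⟩ := hu
  have hau : π a < u := hau.lt_of_ne fun e => h.notMem_bag ha hRa (e ▸ huB)
  cases hfa : R a with
  | inl v => exact absurd ⟨v, hfa⟩ hRa
  | inr f =>
    cases hgb : R b with
    | inl v => exact absurd ⟨v, hgb⟩ hRb
    | inr g =>
      refine ⟨⟨u, huB⟩, f, g, rfl, rfl, ?_, ?_⟩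
      · rw [← h.2.2.2.2.2 a ha f hfa, phi_eq_lt_iff]
        exact hau
      · rw [← h.2.2.2.2.2 b hb g hgb, phi_eq_gt_iff]
        exact hub

theorem IsBTRPlan.lt_of_separating {S U : Type*} [PartialOrder U] {L : S → Set U}
    {Gne Glt : S → S → Prop} {Bag A A' : Set U} {T₁ T₂ : Set S} {R : S → ↥Bag ⊕ (↥Bag → Rel3)}
    {π₁ π₂ : S → U} (h₁ : IsBTRPlan L Gne Glt Bag A T₁ R π₁)
    (h₂ : IsBTRPlan L Gne Glt Bag A' T₂ R π₂) {a b : S} (ha : a ∈ T₁) (hb : b ∈ T₂)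
    (hu : ∃ (u : ↥Bag) (f g : ↥Bag → Rel3),
      R a = Sum.inr f ∧ R b = Sum.inr g ∧ f u = Rel3.lt ∧ g u = Rel3.gt) :
    π₁ a < π₂ b := by
  obtain ⟨u, f, g, hf, hg, hfu, hgu⟩ := hu
  rw [← h₁.2.2.2.2.2 a ha f hf, phi_eq_lt_iff] at hfu
  rw [← h₂.2.2.2.2.2 b hb g hg, phi_eq_gt_iff] at hgu
  exact hfu.trans hgu

/-- Two plans whose sets of steps overlap only in steps assigned to the bag can be glued. -/
theorem IsBTRPlan.exists_glue {S U : Type*} [PartialOrder U] {L : S → Set U}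
    {Gne Glt : S → S → Prop} {Bag A₁ A₂ A : Set U} {X X₁ X₂ : Set S}
    {R : S → ↥Bag ⊕ (↥Bag → Rel3)} {π₁ π₂ : S → U}
    (hX : ∀ x ∈ X, ∃ u, R x = Sum.inl u)
    (hX₁ : ∀ x ∈ X₁, ¬ ∃ u, R x = Sum.inl u) (hX₂ : ∀ x ∈ X₂, ¬ ∃ u, R x = Sum.inl u)
    (hdisj : Disjoint X₁ X₂)
    (h₁ : IsBTRPlan L Gne Glt Bag A₁ (X ∪ X₁) R π₁)
    (h₂ : IsBTRPlan L Gne Glt Bag A₂ (X ∪ X₂) R π₂)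
    (hA₁ : A₁ ⊆ A) (hA₂ : A₂ ⊆ A) (hA : A₁ ∩ A₂ ⊆ Bag)
    (hlt : ∀ a b : S, Glt a b → ((a ∈ X₁ ∧ b ∈ X₂) ∨ (a ∈ X₂ ∧ b ∈ X₁)) →
      ∃ (u : ↥Bag) (f g : ↥Bag → Rel3),
        R a = Sum.inr f ∧ R b = Sum.inr g ∧ f u = Rel3.lt ∧ g u = Rel3.gt) :
    ∃ π : S → U, IsBTRPlan L Gne Glt Bag A (X ∪ (X₁ ∪ X₂)) R π := by
  classical
  set π : S → U := fun x => if x ∈ X₂ then π₂ x else π₁ x with hπ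
  have e₁ : ∀ x ∈ X ∪ X₁, π x = π₁ x := by
    rintro x (hx | hx)
    · have : x ∉ X₂ := fun h => hX₂ x h (hX x hx)
      simp [hπ, this]
    · simp [hπ, Set.disjoint_left.1 hdisj hx]
  have e₂ : ∀ x ∈ X ∪ X₂, π x = π₂ x := by
    rintro x (hx | hx)
    · obtain ⟨u, hu⟩ := hX x hx
      rw [e₁ x (Or.inl hx), (h₁.2.2.2.2.1 x (Or.inl hx) u).2 hu,
        (h₂.2.2.2.2.1 x (Or.inl hx) u).2 hu]
    · simp [hπ, hx]
  have hne : ∀ x ∈ X₁, ∀ y ∈ X₂, π x ≠ π y := by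
    intro x hx y hy h
    rw [e₁ x (Or.inr hx), e₂ y (Or.inr hy)] at h
    exact h₁.notMem_bag (Or.inr hx) (hX₁ x hx)
      (hA ⟨h₁.2.2.2.1 x (Or.inr hx), h ▸ h₂.2.2.2.1 y (Or.inr hy)⟩)
  have hcases : ∀ x ∈ X ∪ (X₁ ∪ X₂), x ∈ X ∪ X₁ ∨ x ∈ X ∪ X₂ := by
    rintro x (h | h | h)
    exacts [Or.inl (Or.inl h), Or.inl (Or.inr h), Or.inr (Or.inr h)]
  have hpairs : ∀ x ∈ X ∪ (X₁ ∪ X₂), ∀ y ∈ X ∪ (X₁ ∪ X₂),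
      (x ∈ X ∪ X₁ ∧ y ∈ X ∪ X₁) ∨ (x ∈ X ∪ X₂ ∧ y ∈ X ∪ X₂) ∨
        (x ∈ X₁ ∧ y ∈ X₂) ∨ (x ∈ X₂ ∧ y ∈ X₁) := by
    simp only [Set.mem_union]
    tauto
  refine ⟨π, fun x hx => ?_, fun x hx y hy hxy => ?_, fun x hx y hy hxy => ?_, fun x hx => ?_,
    fun x hx => ?_, fun x hx => ?_⟩
  · obtain h | h := hcases x hx
    · exact e₁ x h ▸ h₁.1 x h
    · exact e₂ x h ▸ h₂.1 x h
  · obtain ⟨h, h'⟩ | ⟨h, h'⟩ | ⟨h, h'⟩ | ⟨h, h'⟩ := hpairs x hx y hy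
    · rw [e₁ x h, e₁ y h']
      exact h₁.2.1 x h y h' hxy
    · rw [e₂ x h, e₂ y h']
      exact h₂.2.1 x h y h' hxy
    · exact hne x h y h'
    · exact (hne y h' x h).symm
  · obtain ⟨h, h'⟩ | ⟨h, h'⟩ | ⟨h, h'⟩ | ⟨h, h'⟩ := hpairs x hx y hy
    · rw [e₁ x h, e₁ y h']
      exact h₁.2.2.1 x h y h' hxy
    · rw [e₂ x h, e₂ y h']
      exact h₂.2.2.1 x h y h' hxy
    · rw [e₁ x (Or.inr h), e₂ y (Or.inr h')]
      exact h₁.lt_of_separating h₂ (Or.inr h) (Or.inr h') (hlt x y hxy (Or.inl ⟨h, h'⟩))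
    · rw [e₂ x (Or.inr h), e₁ y (Or.inr h')]
      exact h₂.lt_of_separating h₁ (Or.inr h) (Or.inr h') (hlt x y hxy (Or.inr ⟨h, h'⟩))
  · obtain h | h := hcases x hx
    · exact hA₁ (e₁ x h ▸ h₁.2.2.2.1 x h)
    · exact hA₂ (e₂ x h ▸ h₂.2.2.2.1 x h)
  · obtain h | h := hcases x hx
    · exact e₁ x h ▸ h₁.2.2.2.2.1 x h
    · exact e₂ x h ▸ h₂.2.2.2.2.1 x h
  · obtain h | h := hcases x hx
    · exact e₁ x h ▸ h₁.2.2.2.2.2 x h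
    · exact e₂ x h ▸ h₂.2.2.2.2.2 x h

/-- Join node.  Let `(T, Bags)` be a rooted tree decomposition of the Hasse diagram of
`(U, <)` and let `i` be a join node whose two children `i'` and `i''` satisfy
`Bags i' = Bags i'' = Bags i`.  Let `T' ⊆ S`, `R : S → Bags i ⊕ (Bags i → Rel3)`, and
let `X = {x ∈ T' | R x ∈ Bags i}`.  Then a `(Bags i, T', R)`-plan exists iff `T' \ X`
can be partitioned into sets `X'` and `X''` such that a `(Bags i', X ∪ X', R)`-plan and
a `(Bags i'', X ∪ X'', R)`-plan exist (with `R` restricted accordingly), and for every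
arc of the constraint graph between a step of `X'` and a step of `X''` (in either
direction), from `a` to `b` say, there is a user `u ∈ Bags i` such that the coordinate
of the tuple `R a` at `u` is `[<]` and the coordinate of the tuple `R b` at `u` is
`[>]`. -/
theorem stmt_9 {S U ι : Type*} [Fintype S] [Fintype U] [Fintype ι] [PartialOrder U]
    (L : S → Set U) (Gne Glt : S → S → Prop)
    (hGneSymm : ∀ x y, Gne x y → Gne y x)
    (hGneIrr : ∀ x, ¬ Gne x x) (hGltIrr : ∀ x, ¬ Glt x x)
    (T : SimpleGraph ι) (Bags : ι → Set U) (root : ι)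
    (hTree : T.IsTree)
    (hcov : ∀ u : U, ∃ i, u ∈ Bags i)
    (harc : ∀ u v : U, u ⋖ v → ∃ i, u ∈ Bags i ∧ v ∈ Bags i)
    (hconn : ∀ u : U, (T.induce {i | u ∈ Bags i}).Connected)
    (i i' i'' : ι) (hne : i' ≠ i'')
    (hadj' : T.Adj i i') (hdesc' : IsDesc T root i i')
    (hadj'' : T.Adj i i'') (hdesc'' : IsDesc T root i i'')
    (huniq : ∀ j, T.Adj i j → IsDesc T root i j → j = i' ∨ j = i'')
    (hB' : Bags i' = Bags i) (hB'' : Bags i'' = Bags i)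
    (T' : Set S) (R : S → ↥(Bags i) ⊕ (↥(Bags i) → Rel3)) :
    (∃ π : S → U,
        IsBTRPlan L Gne Glt (Bags i) (allowedUsers T root Bags i) T' R π) ↔
      ∃ X' X'' : Set S,
        X' ∪ X'' = T' \ {x | x ∈ T' ∧ ∃ u : ↥(Bags i), R x = Sum.inl u} ∧
        Disjoint X' X'' ∧
        (∃ π : S → U, IsBTRPlan L Gne Glt (Bags i)
          (allowedUsers T root Bags i')
          ({x | x ∈ T' ∧ ∃ u : ↥(Bags i), R x = Sum.inl u} ∪ X') R π) ∧
        (∃ π : S → U, IsBTRPlan L Gne Glt (Bags i)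
          (allowedUsers T root Bags i'')
          ({x | x ∈ T' ∧ ∃ u : ↥(Bags i), R x = Sum.inl u} ∪ X'') R π) ∧
        (∀ a b : S, Glt a b → ((a ∈ X' ∧ b ∈ X'') ∨ (a ∈ X'' ∧ b ∈ X')) →
          ∃ (u : ↥(Bags i)) (f g : ↥(Bags i) → Rel3),
            R a = Sum.inr f ∧ R b = Sum.inr g ∧ f u = Rel3.lt ∧ g u = Rel3.gt) := by
  have hpre : T.Preconnected := hTree.connected.preconnected
  have hdisj := disjoint_subtreeNodes hpre hdesc'.2 hdesc''.2 hadj' hadj'' hne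
  have hcover : ∀ u ∈ allowedUsers T root Bags i,
      u ∈ allowedUsers T root Bags i' ∨ u ∈ allowedUsers T root Bags i'' := by
    intro u hu
    obtain ⟨j, hj, huj⟩ := mem_allowedUsers_iff.1 hu
    obtain rfl | hji := eq_or_ne j i
    · exact Or.inl (Or.inl (hB'.symm ▸ huj))
    · obtain ⟨k, hik, hk, hjk⟩ := exists_child_of_mem_subtreeNodes hTree hj hji
      obtain rfl | rfl := huniq k hik ⟨hik.ne', hk⟩
      · exact Or.inl (mem_allowedUsers_iff.2 ⟨j, hjk, huj⟩)
      · exact Or.inr (mem_allowedUsers_iff.2 ⟨j, hjk, huj⟩)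
  have hinter : allowedUsers T root Bags i' ∩ allowedUsers T root Bags i'' ⊆ Bags i :=
    fun u hu => hB' ▸ mem_bag_of_mem_allowedUsers (hconn u) hdisj hu.1 hu.2
  set X : Set S := {x | x ∈ T' ∧ ∃ u : ↥(Bags i), R x = Sum.inl u} with hX
  constructor
  · rintro ⟨π, hπ⟩
    have hXB : ∀ x ∈ X, π x ∈ Bags i := by
      rintro x ⟨hx, u, hu⟩
      rw [(hπ.2.2.2.2.1 x hx u).2 hu]
      exact u.2
    have hR : ∀ x ∈ T' \ X, ¬ ∃ u, R x = Sum.inl u := fun x hx h => hx.2 ⟨hx.1, h⟩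
    refine ⟨{x ∈ T' \ X | π x ∈ allowedUsers T root Bags i'},
      {x ∈ T' \ X | π x ∉ allowedUsers T root Bags i'}, ?_, ?_, ⟨π, hπ.mono ?_ ?_⟩,
      ⟨π, hπ.mono ?_ ?_⟩, ?_⟩
    · ext x
      simp only [Set.mem_union, Set.mem_ofPred_eq]
      tauto
    · exact Set.disjoint_left.2 fun x h h' => h'.2 h.2
    · rintro x (h | h)
      exacts [h.1, h.1.1]
    · rintro x (h | h)
      exacts [Or.inl (hB'.symm ▸ hXB x h), h.2]
    · rintro x (h | h)
      exacts [h.1, h.1.1]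
    · rintro x (h | h)
      exacts [Or.inl (hB''.symm ▸ hXB x h), (hcover _ (hπ.2.2.2.1 x h.1.1)).resolve_left h.2]
    · rintro a b hab (⟨ha, hb⟩ | ⟨ha, hb⟩) <;>
        refine hπ.exists_separating_of_between ha.1.1 hb.1.1 (hR a ha.1) (hR b hb.1) ?_ <;>
        have hlt := hπ.2.2.1 a ha.1.1 b hb.1.1 hab
      · exact hB' ▸ exists_mem_bag_between harc hconn hlt ha.2 hb.2
      · exact hB'' ▸ exists_mem_bag_between harc hconn hlt
          ((hcover _ (hπ.2.2.2.1 a ha.1.1)).resolve_left ha.2)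
          fun h => hπ.notMem_bag hb.1.1 (hR b hb.1) (hinter ⟨hb.2, h⟩)
  · rintro ⟨X', X'', hunion, hXdisj, ⟨π', h'⟩, ⟨π'', h''⟩, hlt⟩
    have hR : ∀ x ∈ X' ∪ X'', ¬ ∃ u, R x = Sum.inl u := by
      rw [hunion]
      exact fun x hx h => hx.2 ⟨hx.1, h⟩
    obtain ⟨π, hπ⟩ := IsBTRPlan.exists_glue (X := X) (fun x hx => hx.2)
      (fun x hx => hR x (Or.inl hx)) (fun x hx => hR x (Or.inr hx)) hXdisj h' h''
      (allowedUsers_mono hdesc'.2) (allowedUsers_mono hdesc''.2) hinter hlt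
    rw [hunion, Set.union_sdiff_cancel fun x hx => hx.1] at hπ
    exact ⟨π, hπ⟩
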